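/- Let n ≥ 6. For every ε > 0 there exist points p_1, …, p_n ∈ ℝ² in strictly convex position in counterclockwise order, with convex hull P, such that every convex polygon Q circumscribed about P satisfies area(Q) < (1 + ε)·area(P). -/

import Mathlib

open MeasureTheory

noncomputable section

/-- The plane. -/
abbrev E2 := EuclideanSpace ℝ (Fin 2)

/-- Cross product of two planar vectors. -/
def cross2 (u v : E2) : ℝ := u 0 * v 1 - u 1 * v 0

/-- A convex polygon: the convex hull of a finite set of points. -/
def IsConvexPolygon (Q : Set E2) : Prop := ∃ F : Finset E2, Q = convexHull ℝ (F : Set E2)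

/-- The vertices of a triangle whose sides are bulged outwards: one vertex on each of the first two
sides, and the remaining ones on a parabolic arc replacing the third side. -/
def bulgedTriangle (c N : ℝ) : ℕ → E2
  | 0 => !₂[0, 0]
  | 1 => !₂[1 / 2, -(c / 4)]
  | 2 => !₂[1, 0]
  | 3 => !₂[1 / 2 + c / 4, 1 / 2]
  | k + 4 => !₂[-(c * (k / N) * (1 - k / N)), 1 - k / N + c * (k / N) * (1 - k / N)]

/-- The triangle with vertices `(0, 0)`, `(1, 0)`, `(0, 1)`. -/
def stdTriangle : Set E2 := {q | 0 ≤ q 0 ∧ 0 ≤ q 1 ∧ q 0 + q 1 ≤ 1}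

lemma cross2_bulgedTriangle_pos {c N : ℝ} (hc : 0 < c) (hc' : c ≤ 1 / 8) (hN : 2 ≤ N) (k : ℕ) :
    0 < cross2 (bulgedTriangle c N (k + 1) - bulgedTriangle c N k)
      (bulgedTriangle c N (k + 2) - bulgedTriangle c N (k + 1)) := by
  have hN0 : 0 < N := by linarith
  have hh : 0 < 1 / N := by positivity
  have hh' : 1 / N ≤ 1 / 2 := one_div_le_one_div_of_le (by norm_num) hN
  match k with
  | 0 => simp [cross2, bulgedTriangle]; nlinarith
  | 1 => simp [cross2, bulgedTriangle]; nlinarith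
  | 2 => simp [cross2, bulgedTriangle]; nlinarith
  | 3 =>
    simp only [cross2, bulgedTriangle, PiLp.sub_apply]
    simp
    rw [one_div] at hh hh'
    generalize N⁻¹ = h at *
    have h1 : 0 < c * (1 - h) := by nlinarith
    have h2 : c * (1 - h) < 1 := by nlinarith
    have h3 : 0 < h * ((1 / 2 + c / 4) * (1 - c * (1 - h)) + c * (1 - h) / 2) := by
      have : 0 < 1 - c * (1 - h) := by linarith
      positivity
    linear_combination h3
  | k + 4 =>
    have h3 : 0 < 2 * c * (1 / N) ^ 3 := by positivity
    have e1 : ((k + 1 : ℕ) : ℝ) / N = k / N + 1 / N := by push_cast; ring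
    have e2 : ((k + 2 : ℕ) : ℝ) / N = k / N + 2 * (1 / N) := by push_cast; ring
    simp only [cross2, bulgedTriangle, PiLp.sub_apply, e1, e2]
    simp only [Matrix.cons_val_zero, Matrix.cons_val_one]
    linear_combination h3

lemma bulgedTriangle_natCast_add_four {c N : ℝ} (hN : N ≠ 0) {m : ℕ} (hm : (m : ℝ) = N) :
    bulgedTriangle c N (m + 4) = bulgedTriangle c N 0 := by
  simp [bulgedTriangle, hm, hN]

lemma cross2_bulgedTriangle_last_pos {c N : ℝ} (hc : 0 < c) (hc' : c ≤ 1 / 8) (hN : 2 ≤ N)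
    {m : ℕ} (hm : (m : ℝ) + 1 = N) :
    0 < cross2 (bulgedTriangle c N 0 - bulgedTriangle c N (m + 4))
      (bulgedTriangle c N 1 - bulgedTriangle c N 0) := by
  have hN0 : 0 < N := by linarith
  have hh : 0 < 1 / N := by positivity
  have hh' : 1 / N ≤ 1 / 2 := one_div_le_one_div_of_le (by norm_num) hN
  have e : (m : ℝ) / N = 1 - 1 / N := by rw [← hm]; field_simp; ring
  simp only [cross2, bulgedTriangle, PiLp.sub_apply, e]
  simp only [Matrix.cons_val_zero, Matrix.cons_val_one]
  generalize 1 / N = h at *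
  have h1 : 0 < c * h * (1 - h) := mul_pos (mul_pos hc hh) (by linarith)
  nlinarith

/-- Consecutive edges of the bulged triangle turn left. -/
lemma cross2_bulgedTriangle_zmod_pos {n : ℕ} (hn : 6 ≤ n) {c : ℝ} (hc : 0 < c) (hc' : c ≤ 1 / 8)
    (i : ZMod n) :
    0 < cross2 (bulgedTriangle c (n - 4) (i + 1).val - bulgedTriangle c (n - 4) i.val)
      (bulgedTriangle c (n - 4) (i + 2).val - bulgedTriangle c (n - 4) (i + 1).val) := by
  have : NeZero n := ⟨by omega⟩
  obtain ⟨m, rfl⟩ : ∃ m, n = m + 5 := ⟨n - 5, by omega⟩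
  have hN : (2 : ℝ) ≤ ((m + 5 : ℕ) : ℝ) - 4 := by
    have : (6 : ℝ) ≤ ((m + 5 : ℕ) : ℝ) := by exact_mod_cast hn
    linarith
  have hi := i.val_lt
  have hv (j : ℕ) : (i + (j : ZMod (m + 5))).val = (i.val + j) % (m + 5) := by
    rw [ZMod.val_add, ZMod.val_natCast, Nat.add_mod_mod]
  have v1 : (i + 1).val = (i.val + 1) % (m + 5) := by simpa only [Nat.cast_one] using hv 1
  have v2 : (i + 2).val = (i.val + 2) % (m + 5) := by simpa only [Nat.cast_ofNat] using hv 2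
  rw [v1, v2]
  generalize i.val = k at *
  generalize hNdef : ((m + 5 : ℕ) : ℝ) - 4 = N at *
  push_cast at hNdef
  have key := cross2_bulgedTriangle_pos hc hc' hN k
  have hlast : bulgedTriangle c N (m + 5) = bulgedTriangle c N 0 :=
    bulgedTriangle_natCast_add_four (m := m + 1) (by linarith) (by push_cast; linarith)
  rcases lt_trichotomy (k + 2) (m + 5) with h | h | h
  · rwa [Nat.mod_eq_of_lt (by omega), Nat.mod_eq_of_lt h]
  · rw [Nat.mod_eq_of_lt (by omega), h, Nat.mod_self, ← hlast, ← h]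
    exact key
  · obtain rfl : k = m + 4 := by omega
    rw [Nat.mod_self, show m + 4 + 2 = m + 5 + 1 by rfl, Nat.add_mod_left,
      Nat.mod_eq_of_lt (by omega)]
    exact cross2_bulgedTriangle_last_pos hc hc' hN (by linarith)

/-- A line through a slightly bulged point of a side which supports the triangle stays close to
that side. Here `β` and `γ` are the values of the linear form on the two edge vectors. -/
lemma neg_le_of_support {β γ u v s c : ℝ} (hc : 0 < c) (hs : 0 < s) (hs' : s < 1)
    (h0 : 0 ≤ s * β - c * s * (1 - s) * γ) (h1 : β ≤ s * β - c * s * (1 - s) * γ)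
    (hne : β ≠ 0 ∨ γ ≠ 0) (h : u * β + v * γ ≤ s * β - c * s * (1 - s) * γ) :
    -(c * (|u| + 2)) ≤ v := by
  have h0' : c * (1 - s) * γ ≤ β := by
    by_contra! hlt
    nlinarith [mul_pos hs (sub_pos.2 hlt)]
  have h1' : β ≤ -(c * s * γ) := by
    by_contra! hlt
    nlinarith [mul_pos (sub_pos.2 hs') (sub_pos.2 hlt)]
  have hγ : γ < 0 := by
    by_contra! hγ
    have e1 : 0 ≤ c * (1 - s) * γ := mul_nonneg (mul_nonneg hc.le (by linarith)) hγ
    have e2 : 0 ≤ c * s * γ := by positivity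
    have e3 : β = 0 := by linarith
    have e4 : c * γ = 0 := by nlinarith
    rcases hne with h | h
    · exact h e3
    · exact h ((mul_eq_zero.1 e4).resolve_left hc.ne')
  have hcγ : 0 < c * -γ := mul_pos hc (by linarith)
  have hβ : |β| ≤ c * -γ := by
    rw [abs_le]
    constructor <;> nlinarith
  have k1 : |u * β| ≤ |u| * (c * -γ) := by
    rw [abs_mul]; exact mul_le_mul_of_nonneg_left hβ (abs_nonneg u)
  have k2 : s * β ≤ c * -γ := by
    have := le_abs_self β
    nlinarith [abs_nonneg β]
  have k3 : s * (1 - s) ≤ 1 := by nlinarith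
  have k4 : s * (1 - s) * (c * -γ) ≤ c * -γ := by nlinarith
  have k5 := neg_abs_le (u * β)
  by_contra! hlt
  nlinarith [mul_pos (sub_pos.2 hlt) (neg_pos.2 hγ)]

lemma barycentric_lower_bound {c x y z : ℝ} (hc : 0 < c) (hc' : c ≤ 1 / 8) (hsum : x + y + z = 1)
    (hy : -(c * (|x| + 2)) ≤ y) (hz : -(c * (|y| + 2)) ≤ z) (hx : -(c * (|z| + 2)) ≤ x) :
    -(4 * c) ≤ x ∧ -(4 * c) ≤ y ∧ -(4 * c) ≤ z := by
  obtain ⟨w, hw0, hwx, hwy, hwz, hw⟩ : ∃ w : ℝ, 0 ≤ w ∧ -x ≤ w ∧ -y ≤ w ∧ -z ≤ w ∧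
      (w = 0 ∨ w = -x ∨ w = -y ∨ w = -z) := by
    refine ⟨max (max 0 (-x)) (max (-y) (-z)), by simp, by simp, by simp, by simp, ?_⟩
    rcases max_choice (max 0 (-x)) (max (-y) (-z)) with h | h <;> rw [h]
    · rcases max_choice 0 (-x) with h | h <;> simp [h]
    · rcases max_choice (-y) (-z) with h | h <;> simp [h]
  have ax : |x| ≤ 1 + 2 * w := abs_le.2 ⟨by linarith, by linarith⟩
  have ay : |y| ≤ 1 + 2 * w := abs_le.2 ⟨by linarith, by linarith⟩
  have az : |z| ≤ 1 + 2 * w := abs_le.2 ⟨by linarith, by linarith⟩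
  have bx := mul_le_mul_of_nonneg_left ax hc.le
  have bay := mul_le_mul_of_nonneg_left ay hc.le
  have baz := mul_le_mul_of_nonneg_left az hc.le
  have cw : c * w ≤ 1 / 8 * w := mul_le_mul_of_nonneg_right hc' hw0
  have : w ≤ 4 * c := by
    rcases hw with h | h | h | h <;> nlinarith
  exact ⟨by linarith, by linarith, by linarith⟩

/-- A convex set with nonempty interior has a supporting line at each point of its frontier. -/
lemma exists_support_of_mem_frontier {Q : Set E2} (hQ : Convex ℝ Q) (hint : (interior Q).Nonempty)
    {m : E2} (hm : m ∈ frontier Q) :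
    ∃ a b : ℝ, (a ≠ 0 ∨ b ≠ 0) ∧ ∀ q ∈ Q, a * q 0 + b * q 1 ≤ a * m 0 + b * m 1 := by
  obtain ⟨f, hf⟩ := geometric_hahn_banach_open_point hQ.interior isOpen_interior hm.2
  have hrep (q : E2) :
      f q = f (EuclideanSpace.single 0 1) * q 0 + f (EuclideanSpace.single 1 1) * q 1 := by
    have : q = q 0 • EuclideanSpace.single 0 (1 : ℝ) + q 1 • EuclideanSpace.single 1 (1 : ℝ) := by
      ext i; fin_cases i <;> simp
    conv_lhs => rw [this]
    simp [mul_comm]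
  refine ⟨f (EuclideanSpace.single 0 1), f (EuclideanSpace.single 1 1), ?_, fun q hq => ?_⟩
  · obtain ⟨q, hq⟩ := hint
    have := hf q hq
    by_contra! h
    rw [hrep q, hrep m, h.1, h.2] at this
    simp at this
  · rw [← hrep, ← hrep]
    have hcl : q ∈ closure (interior Q) := by
      rw [hQ.closure_interior_eq_closure_of_nonempty_interior hint]
      exact subset_closure hq
    exact closure_minimal (fun x hx => (hf x hx).le)
      (isClosed_le f.continuous continuous_const) hcl

lemma interior_stdTriangle_nonempty : (interior stdTriangle).Nonempty := by
  have ho : IsOpen {q : E2 | 0 < q 0 ∧ 0 < q 1 ∧ q 0 + q 1 < 1} :=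
    (isOpen_lt continuous_const (g := fun q : E2 => q 0) (by fun_prop)).inter
      ((isOpen_lt continuous_const (g := fun q : E2 => q 1) (by fun_prop)).inter
        (isOpen_lt (f := fun q : E2 => q 0 + q 1) (by fun_prop) continuous_const))
  refine ⟨!₂[1 / 3, 1 / 3], interior_maximal (s := stdTriangle) ?_ ho ?_⟩
  · exact fun q hq => ⟨hq.1.le, hq.2.1.le, hq.2.2.le⟩
  · refine ⟨?_, ?_, ?_⟩ <;> norm_num

lemma stdTriangle_subset {S : Set E2} (hS : Convex ℝ S) (hA : !₂[0, 0] ∈ S) (hB : !₂[1, 0] ∈ S)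
    (hC : !₂[0, 1] ∈ S) : stdTriangle ⊆ S := by
  rintro q ⟨h0, h1, h2⟩
  have h := hS.sum_mem (t := Finset.univ) (w := ![1 - q 0 - q 1, q 0, q 1])
    (z := ![!₂[0, 0], !₂[1, 0], !₂[0, 1]]) ?_ ?_ ?_
  · convert h using 1
    rw [Fin.sum_univ_three]
    ext i; fin_cases i <;> simp
  · intro i _; fin_cases i <;> simp <;> linarith
  · simp [Fin.sum_univ_three]; ring
  · intro i _; fin_cases i <;> simpa

/-- A convex set circumscribed about the bulged triangle is contained in a slight enlargement of the
triangle. -/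
lemma subset_homothety_image {Q : Set E2} {c s : ℝ} (hQ : Convex ℝ Q) (hc : 0 < c)
    (hc' : c ≤ 1 / 8) (hs : 0 < s) (hs' : s < 1) (hT : stdTriangle ⊆ Q)
    (h₁ : !₂[1 / 2, -(c / 4)] ∈ frontier Q) (h₂ : !₂[1 / 2 + c / 4, 1 / 2] ∈ frontier Q)
    (h₃ : !₂[-(c * s * (1 - s)), 1 - s + c * s * (1 - s)] ∈ frontier Q) :
    Q ⊆ AffineMap.homothety (!₂[1 / 3, 1 / 3] : E2) (1 + 12 * c) '' stdTriangle := by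
  have hint : (interior Q).Nonempty := interior_stdTriangle_nonempty.mono (interior_mono hT)
  have hA : !₂[0, 0] ∈ Q := hT (by simp [stdTriangle])
  have hB : !₂[1, 0] ∈ Q := hT (by simp [stdTriangle])
  have hC : !₂[0, 1] ∈ Q := hT (by simp [stdTriangle])
  intro q hq
  have hy : -(c * (|q 0| + 2)) ≤ q 1 := by
    obtain ⟨a, b, hab, h⟩ := exists_support_of_mem_frontier hQ hint h₁
    have hA := h _ hA
    have hB := h _ hB
    have hq := h _ hq
    simp only [Matrix.cons_val_zero, Matrix.cons_val_one] at hA hB hq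
    exact neg_le_of_support (β := a) (γ := b) (s := 1 / 2) hc (by norm_num) (by norm_num)
      (by linarith) (by linarith) hab (by linarith)
  have hz : -(c * (|q 1| + 2)) ≤ 1 - q 0 - q 1 := by
    obtain ⟨a, b, hab, h⟩ := exists_support_of_mem_frontier hQ hint h₂
    have hB := h _ hB
    have hC := h _ hC
    have hq := h _ hq
    simp only [Matrix.cons_val_zero, Matrix.cons_val_one] at hB hC hq
    refine neg_le_of_support (β := b - a) (γ := -a) (s := 1 / 2) hc (by norm_num) (by norm_num)
      (by linarith) (by linarith) ?_ (by linarith)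
    grind
  have hx : -(c * (|1 - q 0 - q 1| + 2)) ≤ q 0 := by
    obtain ⟨a, b, hab, h⟩ := exists_support_of_mem_frontier hQ hint h₃
    have hC := h _ hC
    have hA := h _ hA
    have hq := h _ hq
    simp only [Matrix.cons_val_zero, Matrix.cons_val_one] at hC hA hq
    refine neg_le_of_support (β := -b) (γ := a - b) (s := s) hc hs hs'
      (by linarith) (by linarith) ?_ (by linarith)
    grind
  obtain ⟨bx, bay, bz⟩ := barycentric_lower_bound hc hc' (by ring) hy hz hx
  have hr : 0 < 1 + 12 * c := by linarith
  refine ⟨!₂[(q 0 + 4 * c) / (1 + 12 * c), (q 1 + 4 * c) / (1 + 12 * c)], ⟨?_, ?_, ?_⟩, ?_⟩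
  · exact div_nonneg (by linarith) hr.le
  · exact div_nonneg (by linarith) hr.le
  · simp only [Matrix.cons_val_zero, Matrix.cons_val_one]
    rw [← add_div, div_le_one hr]
    linarith
  · ext i
    fin_cases i <;> simp [AffineMap.homothety_apply] <;> field_simp <;> ring


theorem stmt16 (n : ℕ) (hn : 6 ≤ n) (ε : ℝ) (hε : 0 < ε) :
    ∃ p : ZMod n → E2,
      (∀ i : ZMod n, 0 < cross2 (p (i + 1) - p i) (p (i + 2) - p (i + 1))) ∧
      ∀ Q : Set E2, IsConvexPolygon Q → convexHull ℝ (Set.range p) ⊆ Q →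
        (∀ i : ZMod n, p i ∈ frontier Q) →
        (volume Q).toReal < (1 + ε) * (volume (convexHull ℝ (Set.range p))).toReal := by
  have hn' : (6 : ℝ) ≤ n := by exact_mod_cast hn
  have hn0 : NeZero n := ⟨by omega⟩
  obtain ⟨c, hc, hc', hcε⟩ : ∃ c : ℝ, 0 < c ∧ c ≤ 1 / 8 ∧ 42 * c < ε :=
    ⟨min (1 / 8) (ε / 100), by positivity, min_le_left _ _, by
      have := min_le_right (1 / 8) (ε / 100)
      linarith⟩
  have hval (k : ℕ) (hk : k < 6) : ((k : ZMod n)).val = k := ZMod.val_cast_of_lt (by omega)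
  refine ⟨fun i => bulgedTriangle c (n - 4) i.val,
    cross2_bulgedTriangle_zmod_pos hn hc hc', fun Q hQpoly hPQ hfr => ?_⟩
  obtain ⟨F, rfl⟩ := hQpoly
  set P := convexHull ℝ (Set.range fun i : ZMod n => bulgedTriangle c (n - 4) i.val)
  have hmem (k : ℕ) (hk : k < 6) : bulgedTriangle c (n - 4) k ∈ P :=
    subset_convexHull ℝ _ ⟨(k : ZMod n), by simp only [hval k hk]⟩
  have hfr' (k : ℕ) (hk : k < 6) :
      bulgedTriangle c (n - 4) k ∈ frontier (convexHull ℝ (F : Set E2)) := by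
    simpa only [hval k hk] using hfr k
  have hTP : stdTriangle ⊆ P := stdTriangle_subset (convex_convexHull ℝ _) (hmem 0 (by norm_num))
    (hmem 2 (by norm_num)) (by simpa [bulgedTriangle] using hmem 4 (by norm_num))
  have hsub := subset_homothety_image (s := 1 / ((n : ℝ) - 4)) (convex_convexHull ℝ (F : Set E2))
    hc hc' (one_div_pos.2 (by linarith)) (by rw [div_lt_one (by linarith)]; linarith)
    (hTP.trans hPQ) (hfr' 1 (by norm_num)) (hfr' 3 (by norm_num))
    (by simpa [bulgedTriangle] using hfr' 5 (by norm_num))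
  have hPfin : volume P ≠ ⊤ :=
    ((Set.finite_range _).isCompact_convexHull ℝ).measure_lt_top.ne
  have hTfin : volume stdTriangle ≠ ⊤ := measure_ne_top_of_subset hTP hPfin
  have hTpos : 0 < (volume stdTriangle).toReal :=
    ENNReal.toReal_pos (Measure.measure_pos_of_nonempty_interior volume interior_stdTriangle_nonempty).ne' hTfin
  have hTP' : (volume stdTriangle).toReal ≤ (volume P).toReal :=
    ENNReal.toReal_mono hPfin (measure_mono hTP)
  have hQle : (volume (convexHull ℝ (F : Set E2))).toReal ≤
      (1 + 12 * c) ^ 2 * (volume stdTriangle).toReal := by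
    have hle := measure_mono (μ := volume) hsub
    rw [Measure.addHaar_image_homothety, finrank_euclideanSpace_fin,
      abs_of_nonneg (by positivity)] at hle
    have := ENNReal.toReal_mono (ENNReal.mul_ne_top ENNReal.ofReal_ne_top hTfin) hle
    rwa [ENNReal.toReal_mul, ENNReal.toReal_ofReal (by positivity)] at this
  calc (volume (convexHull ℝ (F : Set E2))).toReal
      ≤ (1 + 12 * c) ^ 2 * (volume stdTriangle).toReal := hQle
    _ < (1 + ε) * (volume stdTriangle).toReal := by
        gcongr
        nlinarith
    _ ≤ (1 + ε) * (volume P).toReal := by gcongr
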